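/- Suppose d' = 2d and (α,β) ∈ F_{p^m} × F_q with (α,β) ≠ (0,0). Let φ_{α,β}(x) = α x^{p^m} + β x^{p^k} + β^{p^{n−k}} x^{p^{n−k}}. Then: if φ_{α,β} has exactly 1 zero in F_q then T(α,β) = −p^m; if φ_{α,β} has exactly p^{2d} zeros then T(α,β) = p^{m+d}; and if φ_{α,β} has exactly p^{4d} zeros then T(α,β) = −p^{m+2d}. -/

import Mathlib

open scoped BigOperators Classical

noncomputable section

/-- The map `φ_{α,β}(x) = α x^{p^m} + β x^{p^k} + β^{p^{n-k}} x^{p^{n-k}}`. -/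
def phiMap (p m n k : ℕ) {F : Type} [Field F] (α β x : F) : F :=
  α * x ^ p ^ m + β * x ^ p ^ k + β ^ p ^ (n - k) * x ^ p ^ (n - k)

/-- The trace-type sum `x ↦ ∑_{i<r} x^{p^{t i}}`; for `x` in the subfield of size
`p^{t·r}` this is the relative trace down to the subfield of size `p^t`. -/
def trSum (p t r : ℕ) {F : Type} [Field F] (x : F) : F :=
  ∑ i ∈ Finset.range r, x ^ p ^ (t * i)

/-- `ζ_p^c = exp(2πi·c̃/p)` for a lift `c̃` of `c : F_p`. -/
noncomputable def expChar (p : ℕ) (c : ZMod p) : ℂ :=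
  Complex.exp (2 * Real.pi * Complex.I * (c.val : ℂ) / (p : ℂ))

/-- Identify an element of the prime field of `F` with an element of `ZMod p`
(the partial inverse of the algebra map). -/
noncomputable def fToZMod (p : ℕ) {F : Type} [Field F] [Algebra (ZMod p) F] (x : F) : ZMod p :=
  letI : Nonempty (ZMod p) := ⟨0⟩
  Function.invFun (algebraMap (ZMod p) F) x

/-- `T(α,β) = ∑_{x ∈ F_q} ζ_p^{Tr^m_1(α x^{p^m+1}) + Tr^n_1(β x^{p^k+1})}`. -/
noncomputable def Tsum (p m n k : ℕ) (F : Type) [Field F] [Fintype F] [Algebra (ZMod p) F]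
    (α β : F) : ℂ :=
  ∑ x : F, expChar p (fToZMod p (trSum p 1 m (α * x ^ (p ^ m + 1))) +
      fToZMod p (trSum p 1 n (β * x ^ (p ^ k + 1))))

/-- `S(α,β,γ) = ∑_{x ∈ F_q} ζ_p^{Tr^m_1(α x^{p^m+1}) + Tr^n_1(β x^{p^k+1} + γ x)}`. -/
noncomputable def Ssum (p m n k : ℕ) (F : Type) [Field F] [Fintype F] [Algebra (ZMod p) F]
    (α β γ : F) : ℂ :=
  ∑ x : F, expChar p (fToZMod p (trSum p 1 m (α * x ^ (p ^ m + 1))) +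
      fToZMod p (trSum p 1 n (β * x ^ (p ^ k + 1) + γ * x)))

/-- `√(q₀*)` where `q₀* = (−1)^{(q₀−1)/2} q₀`. -/
noncomputable def sqrtStar (q0 : ℕ) : ℂ :=
  if q0 % 4 = 1 then (Real.sqrt q0 : ℂ) else Complex.I * (Real.sqrt q0 : ℂ)

/-- `ζ_p = exp(2πi/p)`. -/
noncomputable def zetaC (p : ℕ) : ℂ := Complex.exp (2 * Real.pi * Complex.I / (p : ℂ))

/-- Number of pairs `(α,β) ∈ F_{p^m} × F_q` with `T(α,β) = v`. -/
noncomputable def Tcount (p m n k : ℕ) (F : Type) [Field F] [Fintype F] [Algebra (ZMod p) F]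
    (v : ℂ) : ℕ :=
  Nat.card {ab : F × F // ab.1 ^ p ^ m = ab.1 ∧ Tsum p m n k F ab.1 ab.2 = v}

/-- Number of triples `(α,β,γ) ∈ F_{p^m} × F_q × F_q` with `S(α,β,γ) = v`. -/
noncomputable def Scount (p m n k : ℕ) (F : Type) [Field F] [Fintype F] [Algebra (ZMod p) F]
    (v : ℂ) : ℕ :=
  Nat.card {abc : F × F × F // abc.1 ^ p ^ m = abc.1 ∧ Ssum p m n k F abc.1 abc.2.1 abc.2.2 = v}

/-- Hamming weight of the codeword of `C₁` attached to `(α,β)`: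
the number of `0 ≤ i ≤ q-2` with `Tr^m_t(α π^{i(p^m+1)}) + Tr^n_t(β π^{i(p^k+1)}) ≠ 0`. -/
noncomputable def wt1 (p m n k t : ℕ) {F : Type} [Field F] (π α β : F) : ℕ :=
  Nat.card {i : ℕ // i ≤ p ^ n - 2 ∧
    trSum p t (m / t) (α * π ^ (i * (p ^ m + 1))) +
    trSum p t (n / t) (β * π ^ (i * (p ^ k + 1))) ≠ 0}

/-- Number of pairs `(α,β) ∈ F_{p^m} × F_q` whose `C₁`-codeword has weight `v`. -/
noncomputable def wt1count (p m n k t : ℕ) (F : Type) [Field F] [Fintype F] (π : F) (v : ℕ) : ℕ :=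
  Nat.card {ab : F × F // ab.1 ^ p ^ m = ab.1 ∧ wt1 p m n k t π ab.1 ab.2 = v}

/-- Hamming weight of the codeword of `C₂` attached to `(α,β,γ)`. -/
noncomputable def wt2 (p m n k t : ℕ) {F : Type} [Field F] (π α β γ : F) : ℕ :=
  Nat.card {i : ℕ // i ≤ p ^ n - 2 ∧
    trSum p t (m / t) (α * π ^ (i * (p ^ m + 1))) +
    trSum p t (n / t) (β * π ^ (i * (p ^ k + 1)) + γ * π ^ i) ≠ 0}

/-- Number of triples `(α,β,γ)` whose `C₂`-codeword has weight `v`. -/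
noncomputable def wt2count (p m n k t : ℕ) (F : Type) [Field F] [Fintype F] (π : F) (v : ℕ) : ℕ :=
  Nat.card {abc : F × F × F // abc.1 ^ p ^ m = abc.1 ∧ wt2 p m n k t π abc.1 abc.2.1 abc.2.2 = v}

/-- Weil-sum orthogonality for a function `f` whose polarization under `ψ` is `y * L z`. -/
lemma normSq_sum_of_polarization {F : Type} [Field F] [Fintype F] {ψ : AddChar F ℂ}
    (hψ : ψ.IsPrimitive) {p : ℕ} [CharP F p] (hp : Odd p) {f L : F → F}
    (hL : ∀ y z, ψ (f (y + z)) = ψ (f y) * ψ (f z) * ψ (y * L z))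
    (h0 : f 0 = 0) (hneg : ∀ y, f (-y) = f y) :
    (∑ x, ψ (f x)) * (starRingEnd ℂ) (∑ x, ψ (f x)) =
      (Fintype.card F : ℂ) * (Nat.card {x : F // L x = 0} : ℂ) := by
  have hker : ∀ z, L z = 0 → ψ (f z) = 1 := by
    intro z hz
    have h1 := hL (-z) z
    rw [neg_add_cancel, h0, hneg, hz, mul_zero, AddChar.map_zero_eq_one, mul_one, ← pow_two] at h1
    have h2 : ψ (f z) ^ p = 1 := by
      rw [← AddChar.map_nsmul_eq_pow, nsmul_eq_mul, CharP.cast_eq_zero, zero_mul,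
        AddChar.map_zero_eq_one]
    obtain ⟨r, rfl⟩ := hp
    rwa [pow_succ, pow_mul, ← h1, one_pow, one_mul] at h2
  have hunit : ∀ x, ψ x * (starRingEnd ℂ) (ψ x) = 1 := by
    intro x
    rw [← AddChar.map_neg_eq_conj, ← AddChar.map_add_eq_mul, add_neg_cancel,
      AddChar.map_zero_eq_one]
  calc (∑ x, ψ (f x)) * (starRingEnd ℂ) (∑ x, ψ (f x))
      = ∑ y, ∑ z, ψ (f z) * (starRingEnd ℂ) (ψ (f y)) := by
        rw [map_sum, Finset.sum_mul_sum, Finset.sum_comm]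
    _ = ∑ y, ∑ z, ψ (f (y + z)) * (starRingEnd ℂ) (ψ (f y)) :=
        Finset.sum_congr rfl fun y _ =>
          (Equiv.sum_comp (Equiv.addLeft y) fun z => ψ (f z) * (starRingEnd ℂ) (ψ (f y))).symm
    _ = ∑ y, ∑ z, ψ (f z) * ψ (y * L z) := by
        refine Finset.sum_congr rfl fun y _ => Finset.sum_congr rfl fun z _ => ?_
        rw [hL]
        linear_combination (ψ (f z) * ψ (y * L z)) * hunit (f y)
    _ = ∑ z, ψ (f z) * (if L z = 0 then (Fintype.card F : ℂ) else 0) := by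
        rw [Finset.sum_comm]
        refine Finset.sum_congr rfl fun z _ => ?_
        rw [← Finset.mul_sum, AddChar.sum_mulShift _ hψ]
        push_cast
        rfl
    _ = ∑ z, if L z = 0 then (Fintype.card F : ℂ) else 0 := by
        refine Finset.sum_congr rfl fun z _ => ?_
        split_ifs with h
        · rw [hker z h, one_mul]
        · rw [mul_zero]
    _ = _ := by
        rw [← Finset.sum_filter, Finset.sum_const, Nat.card_eq_fintype_card,
          Fintype.card_subtype, nsmul_eq_mul, mul_comm]

/-- Values of an additive character of a field of positive characteristic are integral. -/
lemma isIntegral_addChar {F : Type} [Field F] {p : ℕ} [CharP F p] (hp : 0 < p)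
    (ψ : AddChar F ℂ) (x : F) : IsIntegral ℤ (ψ x) := by
  refine IsIntegral.of_pow hp ?_
  rw [← AddChar.map_nsmul_eq_pow, nsmul_eq_mul, CharP.cast_eq_zero, zero_mul,
    AddChar.map_zero_eq_one]
  exact isIntegral_one

/-- A sum over `F` of algebraic integers depending only on `x ^ N` is congruent modulo `N`
to its value at `0`, when `N ∣ #F - 1`. -/
lemma exists_sum_comp_pow_eq {F : Type} [Field F] [Fintype F] {N : ℕ} (hN0 : N ≠ 0)
    (hN : N ∣ Fintype.card F - 1) (H : F → ℂ) (hH : ∀ x, IsIntegral ℤ (H x)) :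
    ∃ A : ℂ, IsIntegral ℤ A ∧ ∑ x : F, H (x ^ N) = H 0 + N * A := by
  let g : Fˣ →* Fˣ := powMonoidHom N
  refine ⟨∑ y ∈ Finset.univ.image g, H (y : F), IsIntegral.sum _ fun _ _ => hH _, ?_⟩
  have hfib : ∀ y ∈ Finset.univ.image g, (Finset.univ.filter fun u => g u = y).card = N := by
    intro y hy
    have hy' : y ∈ Set.range g := by simpa using hy
    rw [MonoidHom.card_fiber_eq_of_mem_range g hy' ⟨1, map_one g⟩]
    have h := IsCyclic.card_powMonoidHom_ker (G := Fˣ) N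
    rw [Nat.card_eq_fintype_card (α := Fˣ), Fintype.card_units, Nat.gcd_eq_right hN,
      Nat.card_eq_fintype_card] at h
    rw [← h, ← Fintype.card_subtype]
    exact Fintype.card_congr (Equiv.refl _)
  have h1 : ∑ u : Fˣ, H ((u : F) ^ N) = ∑ y ∈ Finset.univ.image g, (N : ℂ) * H (y : F) := by
    rw [← Finset.sum_fiberwise_of_maps_to (t := Finset.univ.image g) (g := g)
      (fun u _ => Finset.mem_image_of_mem g (Finset.mem_univ u))]
    refine Finset.sum_congr rfl fun y hy => ?_
    rw [Finset.sum_congr rfl (g := fun _ => H (y : F)), Finset.sum_const, hfib y hy, nsmul_eq_mul]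
    intro u hu
    rw [← (Finset.mem_filter.mp hu).2]
    simp [g]
  have h2 : ∑ x : F, H (x ^ N) = H 0 + ∑ u : Fˣ, H ((u : F) ^ N) := by
    rw [Fintype.sum_eq_add_sum_subtype_ne _ (0 : F), zero_pow hN0]
    congr 1
    exact (Equiv.sum_comp unitsEquivNeZero fun x : {x : F // x ≠ 0} => H ((x : F) ^ N)).symm
  rw [h2, h1, Finset.mul_sum]

/-- In a finite field, `-1` is an `N`-th power as soon as `2 * N ∣ #F - 1`. -/
lemma exists_pow_eq_neg_one {F : Type} [Field F] [Fintype F] {N : ℕ}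
    (hN : 2 * N ∣ Fintype.card F - 1) : ∃ w : F, w ^ N = -1 := by
  obtain ⟨g, hg⟩ := IsCyclic.exists_ofOrder_eq_natCard (α := Fˣ)
  rw [Nat.card_eq_fintype_card, Fintype.card_units] at hg
  obtain ⟨c, hc⟩ := hN
  have hpos : 0 < Fintype.card F - 1 := Nat.sub_pos_of_lt Fintype.one_lt_card
  have h1 : (((g ^ c) ^ N) ^ 2 : Fˣ) = 1 := by
    rw [← pow_mul, ← pow_mul, ← orderOf_dvd_iff_pow_eq_one, hg, hc]
    exact ⟨1, by ring⟩
  have h2 : ((g ^ c) ^ N : Fˣ) ≠ 1 := by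
    rw [← pow_mul, Ne, ← orderOf_dvd_iff_pow_eq_one, hg]
    intro h
    rw [hc] at h hpos
    have hcN : 0 < c * N := by
      rcases Nat.eq_zero_or_pos (c * N) with h0 | h0
      · rw [show 2 * N * c = 2 * (c * N) by ring, h0] at hpos
        omega
      · exact h0
    have := Nat.le_of_dvd hcN h
    nlinarith
  refine ⟨((g ^ c : Fˣ) : F), ?_⟩
  have h3 : (((g ^ c : Fˣ) : F) ^ N) ^ 2 = 1 := by simpa using congrArg Units.val h1
  rcases sq_eq_one_iff.mp h3 with h | h
  · exact absurd (Units.ext (by simpa using h)) h2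
  · exact h

/-- For odd `P` and odd `r`, the quotient of `P ^ r + 1` by `P + 1` is odd. -/
lemma exists_odd_pow_add_one {P : ℕ} (hP : Odd P) {r : ℕ} (hr : Odd r) :
    ∃ a, Odd a ∧ P ^ r + 1 = (P + 1) * a := by
  obtain ⟨j, rfl⟩ := hr
  obtain ⟨e, rfl⟩ := hP
  induction j with
  | zero => exact ⟨1, odd_one, by ring⟩
  | succ j ih =>
    obtain ⟨a, ⟨c, rfl⟩, ha⟩ := ih
    refine ⟨2 * ((2 * e + 1) ^ 2 * c + (2 * e + 1) * e) + 1, ⟨_, rfl⟩, ?_⟩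
    have : (2 * e + 1) ^ (2 * (j + 1) + 1) + (2 * e + 1) ^ 2
        = (2 * e + 1) ^ 2 * ((2 * e + 1) ^ (2 * j + 1) + 1) := by ring
    rw [ha] at this
    have h2 := this
    zify at h2 ⊢
    linear_combination h2

/-- If integers `t` and `u` differ by `N` times an algebraic integer, then `N ∣ t - u`. -/
lemma int_dvd_sub_of_eq_add_mul {N : ℕ} (hN : N ≠ 0) {t u : ℤ} {A : ℂ} (hA : IsIntegral ℤ A)
    (h : (t : ℂ) = u + N * A) : (N : ℤ) ∣ t - u := by
  have hNC : (N : ℂ) ≠ 0 := by exact_mod_cast hN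
  have hAr : A = algebraMap ℚ ℂ ((t - u : ℚ) / N) := by
    simp only [eq_ratCast]
    push_cast
    field_simp
    linear_combination -h
  rw [hAr, isIntegral_algebraMap_iff (algebraMap ℚ ℂ).injective] at hA
  obtain ⟨c, hc⟩ := IsIntegrallyClosed.isIntegral_iff.mp hA
  refine ⟨c, ?_⟩
  have hNQ : (N : ℚ) ≠ 0 := by exact_mod_cast hN
  simp only [eq_intCast] at hc
  field_simp at hc
  have : (t - u : ℚ) = N * c := by linear_combination -hc
  exact_mod_cast this

/-- The canonical additive character of a finite field of characteristic `p`. -/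
def traceChar (p : ℕ) [NeZero p] (F : Type) [Field F] [Algebra (ZMod p) F] : AddChar F ℂ :=
  (ZMod.stdAddChar (N := p)).compAddMonoidHom (Algebra.trace (ZMod p) F).toAddMonoidHom

lemma traceChar_isPrimitive (p : ℕ) [Fact p.Prime] (F : Type) [Field F] [Finite F]
    [Algebra (ZMod p) F] : (traceChar p F).IsPrimitive := by
  intro a ha h
  apply ha
  apply (traceForm_nondegenerate (ZMod p) F).1 a
  intro b
  rw [Algebra.traceForm_apply]
  have hb : traceChar p F (a * b) = 1 := by
    simpa [AddChar.mulShift_apply] using DFunLike.congr_fun h b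
  apply ZMod.injective_stdAddChar
  rw [AddChar.map_zero_eq_one]
  exact hb

lemma traceChar_pow (p : ℕ) [Fact p.Prime] {F : Type} [Field F] [Fintype F]
    [Algebra (ZMod p) F] (j : ℕ) (x : F) : traceChar p F (x ^ p ^ j) = traceChar p F x := by
  have h : ∀ y : F, Algebra.trace (ZMod p) F (y ^ p) = Algebra.trace (ZMod p) F y := by
    intro y
    have := Algebra.trace_eq_of_algEquiv (FiniteField.frobeniusAlgEquivOfAlgebraic (ZMod p) F) y
    simpa using this
  induction j with
  | zero => simp
  | succ j ih =>
    rw [pow_succ, pow_mul]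
    exact (congrArg ZMod.stdAddChar (h _)).trans ih

lemma expChar_eq_stdAddChar (p : ℕ) [NeZero p] (c : ZMod p) :
    expChar p c = ZMod.stdAddChar c := by
  rw [ZMod.stdAddChar_apply, ZMod.toCircle_apply, expChar]

lemma fToZMod_algebraMap (p : ℕ) [Fact p.Prime] {F : Type} [Field F] [Algebra (ZMod p) F]
    (c : ZMod p) : fToZMod p (algebraMap (ZMod p) F c) = c :=
  Function.leftInverse_invFun (algebraMap (ZMod p) F).injective c

lemma trSum_eq_trace {p n : ℕ} [Fact p.Prime] {F : Type} [Field F] [Fintype F]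
    [Algebra (ZMod p) F] (hF : Fintype.card F = p ^ n) (x : F) :
    trSum p 1 n x = algebraMap (ZMod p) F (Algebra.trace (ZMod p) F x) := by
  have hn : Module.finrank (ZMod p) F = n := by
    have h := Module.card_eq_pow_finrank (K := ZMod p) (V := F)
    rw [hF, ZMod.card] at h
    exact (Nat.pow_right_injective (Fact.out : p.Prime).two_le h).symm
  rw [FiniteField.algebraMap_trace_eq_sum_pow, hn, trSum]
  simp

/-- On the fixed field of `x ↦ x ^ p ^ m`, the trace from the quadratic extension is twice the
trace. -/
lemma trSum_two_mul {p m : ℕ} {F : Type} [Field F] {u : F} (hu : u ^ p ^ m = u) :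
    trSum p 1 (2 * m) u = 2 * trSum p 1 m u := by
  rw [trSum, trSum, two_mul, Finset.sum_range_add, two_mul]
  congr 1
  refine Finset.sum_congr rfl fun i _ => ?_
  rw [one_mul, one_mul, pow_add, pow_mul, hu]

/-- The sum `T(α,β)` as a Weil sum for the canonical additive character. -/
lemma Tsum_eq_sum_traceChar {p m k : ℕ} [Fact p.Prime] {F : Type} [Field F] [Fintype F]
    [Algebra (ZMod p) F] (hp2 : (2 : F) ≠ 0) (hF : Fintype.card F = p ^ (2 * m))
    {α : F} (hα : α ^ p ^ m = α) (β : F) :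
    Tsum p m (2 * m) k F α β =
      ∑ x : F, traceChar p F (α / 2 * x ^ (p ^ m + 1) + β * x ^ (p ^ k + 1)) := by
  refine Finset.sum_congr rfl fun x => ?_
  intro _
  have hfix : (α * x ^ (p ^ m + 1)) ^ p ^ m = α * x ^ (p ^ m + 1) := by
    have hx : (x ^ p ^ m) ^ p ^ m = x := by
      rw [← pow_mul, ← pow_add, ← two_mul, ← hF, FiniteField.pow_card]
    rw [mul_pow, hα, pow_succ, mul_pow, hx, mul_comm x]
  have h1 : trSum p 1 m (α * x ^ (p ^ m + 1)) = algebraMap (ZMod p) F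
      (Algebra.trace (ZMod p) F (α / 2 * x ^ (p ^ m + 1))) := by
    have h2 := trSum_two_mul hfix
    have h3 : α * x ^ (p ^ m + 1) = α / 2 * x ^ (p ^ m + 1) + α / 2 * x ^ (p ^ m + 1) := by
      field_simp
      ring
    apply mul_left_cancel₀ hp2
    rw [← h2, trSum_eq_trace hF, two_mul, ← map_add, ← map_add, ← h3]
  rw [h1, trSum_eq_trace hF, fToZMod_algebraMap, fToZMod_algebraMap, expChar_eq_stdAddChar,
    ← map_add]
  rfl

/-- The polarization of the quadratic form defining `T(α,β)` is represented by `φ_{α,β}`. -/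
lemma traceChar_polarization {p m k : ℕ} [Fact p.Prime] {F : Type} [Field F] [Fintype F]
    [Algebra (ZMod p) F] (hp2 : (2 : F) ≠ 0) (hF : Fintype.card F = p ^ (2 * m))
    (hk : k ≤ 2 * m) {α : F} (hα : α ^ p ^ m = α) (β y z : F) :
    traceChar p F (α / 2 * (y + z) ^ (p ^ m + 1) + β * (y + z) ^ (p ^ k + 1)) =
      traceChar p F (α / 2 * y ^ (p ^ m + 1) + β * y ^ (p ^ k + 1)) *
      traceChar p F (α / 2 * z ^ (p ^ m + 1) + β * z ^ (p ^ k + 1)) *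
      traceChar p F (y * phiMap p m (2 * m) k α β z) := by
  have : CharP F p := charP_of_injective_algebraMap (algebraMap (ZMod p) F).injective p
  have hcard : ∀ x : F, x ^ p ^ (2 * m) = x := fun x => by rw [← hF, FiniteField.pow_card]
  have h2 : (2 : F) ^ p ^ m = 2 := by
    have h := map_ofNat (iterateFrobenius F p m) 2
    rwa [iterateFrobenius_def] at h
  have e1 : traceChar p F (α / 2 * (y ^ p ^ m * z)) = traceChar p F (y * (α / 2 * z ^ p ^ m)) := by
    rw [← traceChar_pow p m (α / 2 * (y ^ p ^ m * z)), mul_pow, mul_pow, div_pow, hα, h2,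
      ← pow_mul, ← pow_add, ← two_mul, hcard]
    congr 1
    ring
  have e2 : traceChar p F (β * (y ^ p ^ k * z)) =
      traceChar p F (y * (β ^ p ^ (2 * m - k) * z ^ p ^ (2 * m - k))) := by
    rw [← traceChar_pow p (2 * m - k) (β * (y ^ p ^ k * z)), mul_pow, mul_pow,
      ← pow_mul, ← pow_add, Nat.add_sub_cancel' hk, hcard]
    congr 1
    ring
  have e3 : α / 2 * (y + z) ^ (p ^ m + 1) + β * (y + z) ^ (p ^ k + 1) =
      (α / 2 * y ^ (p ^ m + 1) + β * y ^ (p ^ k + 1)) +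
      (α / 2 * z ^ (p ^ m + 1) + β * z ^ (p ^ k + 1)) +
      (α / 2 * (y ^ p ^ m * z) + β * (y ^ p ^ k * z) +
        y * (α / 2 * z ^ p ^ m + β * z ^ p ^ k)) := by
    rw [pow_succ (y + z), pow_succ (y + z), add_pow_char_pow, add_pow_char_pow]
    ring
  have e4 : y * phiMap p m (2 * m) k α β z = y * (α / 2 * z ^ p ^ m) +
      y * (β ^ p ^ (2 * m - k) * z ^ p ^ (2 * m - k)) +
        y * (α / 2 * z ^ p ^ m + β * z ^ p ^ k) := by
    rw [phiMap]
    field_simp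
    ring
  rw [e3, e4]
  simp only [AddChar.map_add_eq_mul]
  simp only [e1, e2]

/-- When `m / d` and `k / d` are odd, `T(α,β)` is an integer congruent to `1` modulo `p ^ d + 1`,
with absolute value determined by the number of zeros of `φ_{α,β}`. -/
lemma Tsum_eq_of_card {p m k d : ℕ} [Fact p.Prime] (hodd : Odd p) {F : Type} [Field F] [Fintype F]
    [Algebra (ZMod p) F] (hF : Fintype.card F = p ^ (2 * m)) (hk : k ≤ 2 * m)
    {a b : ℕ} (ha : Odd a) (hb : Odd b) (hma : m = d * a) (hkb : k = d * b)
    {α : F} (hα : α ^ p ^ m = α) (β : F) {i : ℕ}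
    (hcard : Nat.card {x : F // phiMap p m (2 * m) k α β x = 0} = p ^ (2 * (d * i))) :
    ∃ t : ℤ, Tsum p m (2 * m) k F α β = t ∧ ((p : ℤ) ^ d + 1) ∣ t - 1 ∧
      (t = p ^ (m + d * i) ∨ t = -p ^ (m + d * i)) := by
  have hp : p.Prime := Fact.out
  have : CharP F p := charP_of_injective_algebraMap (algebraMap (ZMod p) F).injective p
  have hp2 : (2 : F) ≠ 0 := by
    refine Ring.two_ne_zero ?_
    rw [ringChar.eq F p]
    rintro rfl
    exact absurd hodd (by decide)
  have hP : Odd (p ^ d) := hodd.pow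
  obtain ⟨A, hA, hA'⟩ := exists_odd_pow_add_one hP ha
  obtain ⟨B, hB, hB'⟩ := exists_odd_pow_add_one hP hb
  rw [← pow_mul, ← hma] at hA'
  rw [← pow_mul, ← hkb] at hB'
  set N := p ^ d + 1 with hN
  have hq : Fintype.card F - 1 = (p ^ m + 1) * (p ^ m - 1) := by
    rw [hF, mul_comm 2 m, pow_mul]
    exact Nat.sq_sub_sq (p ^ m) 1
  have h2N : 2 * N ∣ Fintype.card F - 1 := by
    rw [hq, mul_comm 2]
    refine mul_dvd_mul ⟨A, hA'⟩ ?_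
    obtain ⟨e, he⟩ := hodd.pow (n := m)
    exact ⟨e, by omega⟩
  set ψ := traceChar p F with hψ
  let f : F → F := fun x => α / 2 * x ^ (p ^ m + 1) + β * x ^ (p ^ k + 1)
  have hT : Tsum p m (2 * m) k F α β = ∑ x, ψ (f x) := Tsum_eq_sum_traceChar hp2 hF hα β
  have hreal : (starRingEnd ℂ) (∑ x, ψ (f x)) = ∑ x, ψ (f x) := by
    obtain ⟨w, hw⟩ := exists_pow_eq_neg_one h2N
    have hw0 : w ≠ 0 := by
      rintro rfl
      rw [zero_pow (by omega)] at hw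
      exact one_ne_zero (neg_eq_zero.mp hw.symm)
    have hfw : ∀ x, f (w * x) = -f x := by
      intro x
      simp only [f]
      rw [mul_pow, mul_pow, hA', hB', pow_mul w, pow_mul w, hw, hA.neg_one_pow, hB.neg_one_pow]
      ring
    rw [map_sum, ← Equiv.sum_comp (Equiv.mulLeft₀ w hw0) fun x => ψ (f x)]
    refine Finset.sum_congr rfl fun x _ => ?_
    rw [← AddChar.map_neg_eq_conj, ← hfw]
    rfl
  have hsq : (∑ x, ψ (f x)) ^ 2 = ((p : ℂ) ^ (m + d * i)) ^ 2 := by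
    have h := normSq_sum_of_polarization (traceChar_isPrimitive p F) hodd (f := f)
      (traceChar_polarization hp2 hF hk hα β) (by simp [f])
      (fun y => by
        simp only [f]
        rw [(hodd.pow.add_one).neg_pow, (hodd.pow.add_one).neg_pow])
    rw [← hψ, hreal, hcard, hF] at h
    rw [pow_two, h]
    push_cast
    ring
  obtain ⟨C, hC, hC'⟩ := exists_sum_comp_pow_eq (F := F) (N := N) (by omega)
    (dvd_trans (dvd_mul_left _ _) h2N) (fun y => ψ (α / 2 * y ^ A + β * y ^ B))
    (fun y => isIntegral_addChar hp.pos ψ _)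
  have hsum : ∑ x, ψ (f x) = 1 + N * C := by
    have hA0 : A ≠ 0 := by rintro rfl; exact absurd hA (by decide)
    have hB0 : B ≠ 0 := by rintro rfl; exact absurd hB (by decide)
    simp only [zero_pow hA0, zero_pow hB0, mul_zero, add_zero, AddChar.map_zero_eq_one,
      ← pow_mul, ← hA', ← hB'] at hC'
    exact hC'
  have key : ∀ t : ℤ, (∑ x, ψ (f x)) = t → ((p : ℤ) ^ d + 1) ∣ t - 1 := by
    intro t ht
    have h := int_dvd_sub_of_eq_add_mul (N := N) (by omega) (t := t) (u := 1) hC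
      (by rw [← ht, hsum]; push_cast; ring)
    rw [hN] at h
    exact_mod_cast h
  rcases sq_eq_sq_iff_eq_or_eq_neg.mp hsq with h | h
  · refine ⟨(p : ℤ) ^ (m + d * i), by rw [hT, h]; push_cast; rfl, key _ ?_, Or.inl rfl⟩
    rw [h]; push_cast; rfl
  · refine ⟨-(p : ℤ) ^ (m + d * i), by rw [hT, h]; push_cast; rfl, key _ ?_, Or.inr rfl⟩
    rw [h]; push_cast; rfl

/-- The sign of `T(α,β)` for an arbitrary corank `2 * i`. -/
lemma Tsum_eq_neg_one_pow_mul {p m k d : ℕ} [Fact p.Prime] (hodd : Odd p) {F : Type} [Field F]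
    [Fintype F] [Algebra (ZMod p) F] (hF : Fintype.card F = p ^ (2 * m)) (hk : k ≤ 2 * m)
    (hd : 0 < d) {a b : ℕ} (ha : Odd a) (hb : Odd b) (hma : m = d * a) (hkb : k = d * b)
    {α : F} (hα : α ^ p ^ m = α) (β : F) {i : ℕ}
    (hcard : Nat.card {x : F // phiMap p m (2 * m) k α β x = 0} = p ^ (2 * (d * i))) :
    Tsum p m (2 * m) k F α β = (-1) ^ (i + 1) * (p : ℂ) ^ (m + d * i) := by
  obtain ⟨t, hT, hdvd, ht⟩ := Tsum_eq_of_card hodd hF hk ha hb hma hkb hα β hcard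
  have hp : p.Prime := Fact.out
  have hp3 : 3 ≤ p := by
    have := hp.two_le
    obtain ⟨e, he⟩ := hodd
    omega
  have hN : (3 : ℤ) < (p : ℤ) ^ d + 1 := by
    have : p ^ 1 ≤ p ^ d := Nat.pow_le_pow_right hp.pos hd
    have : (3 : ℤ) ≤ (p : ℤ) ^ d := by exact_mod_cast (hp3.trans ((pow_one p).symm.le.trans this))
    omega
  have hmod : ((p : ℤ) ^ d + 1) ∣ (p : ℤ) ^ (m + d * i) - (-1) ^ (i + 1) := by
    have h := sub_dvd_pow_sub_pow ((p : ℤ) ^ d) (-1) (a + i)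
    rw [← pow_mul, mul_add, ← hma, pow_add (-1 : ℤ), ha.neg_one_pow] at h
    rwa [pow_succ, mul_comm ((-1 : ℤ) ^ i), ← sub_neg_eq_add]
  suffices t = (-1) ^ (i + 1) * (p : ℤ) ^ (m + d * i) by
    rw [hT, this]; push_cast; rfl
  have hno : ¬ ((p : ℤ) ^ d + 1) ∣ 2 := fun h => by
    have := Int.le_of_dvd two_pos h
    omega
  rcases neg_one_pow_eq_or ℤ (i + 1) with hs | hs <;> rw [hs] at hmod ⊢ <;>
    rcases ht with rfl | rfl
  · ring
  · exact absurd ((dvd_neg.mpr (dvd_add hdvd hmod)).trans (dvd_of_eq (by ring))) hno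
  · exact absurd ((dvd_sub hmod hdvd).trans (dvd_of_eq (by ring))) hno
  · ring

theorem stmt8 (p m k n d d' : ℕ) (hp : Nat.Prime p) (hodd : p % 2 = 1)
    (hm : 0 < m) (hn : n = 2 * m) (hk : k ≤ n - 1) (hkm : k ≠ m)
    (hd : d = Nat.gcd m k) (hd' : d' = Nat.gcd (m + k) (2 * k))
    (F : Type) [Field F] [Fintype F] [Algebra (ZMod p) F] (hF : Fintype.card F = p ^ n) (s : ℕ) (hs : s = n / d) (hcase : d' = 2 * d)
    (α β : F) (hα : α ^ p ^ m = α) (hne : ¬(α = 0 ∧ β = 0)) :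
    (Nat.card {x : F // phiMap p m n k α β x = 0} = 1 →
      Tsum p m n k F α β = -(p : ℂ) ^ m) ∧
    (Nat.card {x : F // phiMap p m n k α β x = 0} = p ^ (2 * d) →
      Tsum p m n k F α β = (p : ℂ) ^ (m + d)) ∧
    (Nat.card {x : F // phiMap p m n k α β x = 0} = p ^ (4 * d) →
      Tsum p m n k F α β = -(p : ℂ) ^ (m + 2 * d)) := by
  subst hn hd
  have : Fact p.Prime := ⟨hp⟩
  have hdpos : 0 < Nat.gcd m k := Nat.gcd_pos_of_pos_left _ hm
  obtain ⟨a, ha⟩ := Nat.gcd_dvd_left m k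
  obtain ⟨b, hb⟩ := Nat.gcd_dvd_right m k
  have hcop : Nat.Coprime a b := by
    have h := Nat.gcd_mul_left (Nat.gcd m k) a b
    rw [← ha, ← hb] at h
    exact Nat.eq_of_mul_eq_mul_left hdpos (by rw [← h, mul_one])
  have hsum : 2 ∣ a + b := by
    have h : 2 * Nat.gcd m k ∣ m + k := by
      rw [← hcase, hd']
      exact Nat.gcd_dvd_left _ _
    obtain ⟨c, hc⟩ := h
    refine ⟨c, Nat.eq_of_mul_eq_mul_left hdpos ?_⟩
    rw [mul_add, ← ha, ← hb, hc]
    ring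
  have hoa : Odd a := by
    rw [← Nat.not_even_iff_odd]
    intro h
    exact Nat.not_coprime_of_dvd_of_dvd one_lt_two h.two_dvd
      ((Nat.dvd_add_right h.two_dvd).mp hsum) hcop
  have hob : Odd b := by
    rw [← Nat.not_even_iff_odd]
    intro h
    exact Nat.not_coprime_of_dvd_of_dvd one_lt_two
      ((Nat.dvd_add_left h.two_dvd).mp hsum) h.two_dvd hcop
  have key := fun i => Tsum_eq_neg_one_pow_mul (i := i) (Nat.odd_iff.mpr hodd) hF (by omega) hdpos
    hoa hob ha hb hα β
  refine ⟨fun h => ?_, fun h => ?_, fun h => ?_⟩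
  · rw [key 0 (by simpa using h)]
    ring
  · rw [key 1 (by rw [h, mul_one])]
    ring
  · rw [key 2 (by rw [h]; ring)]
    ring
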